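/- For every integer n ≥ 4, the Hilbert–Poincaré series of the ideal I_n is given by Σ_{d=0}^∞ (dim_ℂ I_{n,d}) q^d = q^{(n-1)(n-3)}/((q)_1 (q)_{n-3}) + q^{(n-2)(n-1)}/((q)_1 (q)_{n-2}) + q^{n(n-1)}/(q)_n, as an identity of formal power series in q over ℚ, where (q)_s = ∏_{j=1}^s (1 − q^j) and division by (q)_s means multiplication by the inverse of this unit in the formal power series ring. -/

import Mathlib

open MvPolynomial Finset

/-- The ideal `I_n` (degree-`d` component): symmetric polynomials in `n` variables over `ℂ`
vanishing under the substitution `x₂ := x₁`, `x₄ := x₃`, homogeneous of degree `d`. -/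
noncomputable def IComponent (n : ℕ) (hn : 4 ≤ n) (d : ℕ) :
    Submodule ℂ (MvPolynomial (Fin n) ℂ) :=
  (Subalgebra.toSubmodule (MvPolynomial.symmetricSubalgebra (Fin n) ℂ) : Submodule ℂ (MvPolynomial (Fin n) ℂ)) ⊓
  LinearMap.ker (MvPolynomial.aeval (R := ℂ)
      (fun i : Fin n => if (i : ℕ) = 1 then X (⟨0, by omega⟩ : Fin n)
        else if (i : ℕ) = 3 then X (⟨2, by omega⟩ : Fin n) else (X i : MvPolynomial (Fin n) ℂ))).toLinearMap ⊓
  MvPolynomial.homogeneousSubmodule (Fin n) ℂ d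

/-- `(q)_s = ∏_{j=1}^s (1 - q^j)` as a formal power series over `ℚ`. -/
noncomputable def qPoch (s : ℕ) : PowerSeries ℚ :=
  ∏ j ∈ Finset.range s, (1 - (PowerSeries.X : PowerSeries ℚ) ^ (j + 1))

lemma one_sub_X_pow_mul_mk_dvd (k : ℕ) :
    (1 - (PowerSeries.X : PowerSeries ℚ) ^ (k + 1)) *
      PowerSeries.mk (fun d => if (k + 1) ∣ d then (1 : ℚ) else 0) = 1 := by
  ext d
  rw [sub_mul, one_mul, map_sub, PowerSeries.coeff_X_pow_mul', PowerSeries.coeff_one,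
    PowerSeries.coeff_mk]
  split_ifs with h1 h2 h3 h3 h4 h5 h6 <;> (try simp only [PowerSeries.coeff_mk])
  · omega
  · simp [Nat.dvd_sub h1 (dvd_refl _)]
  · simp
  · have := Nat.le_of_dvd (by omega) h1
    omega
  · simp_all
  · rw [if_neg]
    · simp
    · intro h
      exact h1 ((Nat.dvd_sub_iff_left ‹_› (dvd_refl _)).1 h)
  · simp_all
  · simp

lemma constantCoeff_qPoch (s : ℕ) : PowerSeries.constantCoeff (qPoch s) = 1 := by
  simp [qPoch, map_prod]

lemma qPoch_inv_eq_prod (m : ℕ) :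
    (qPoch m)⁻¹ = ∏ i : Fin m,
      PowerSeries.mk (fun d => if ((i : ℕ) + 1) ∣ d then (1 : ℚ) else 0) := by
  rw [PowerSeries.inv_eq_iff_mul_eq_one (by simp [constantCoeff_qPoch]), qPoch,
    Finset.prod_range, ← Finset.prod_mul_distrib]
  exact Finset.prod_eq_one fun i _ => by rw [mul_comm]; exact one_sub_X_pow_mul_mk_dvd _

/-- The exponents of weighted degree `e` for the weights `1, …, m`. -/
abbrev weightSet (m e : ℕ) : Set (Fin m →₀ ℕ) :=
  {μ | Finsupp.weight (fun i : Fin m => (i : ℕ) + 1) μ = e}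

lemma exists_finset_weightSet (m e : ℕ) :
    ∃ S : Finset (Fin m →₀ ℕ), (S : Set (Fin m →₀ ℕ)) = weightSet m e ∧
      PowerSeries.coeff e (qPoch m)⁻¹ = (S.card : ℚ) := by
  classical
  let T := (Finset.univ.finsuppAntidiag e : Finset (Fin m →₀ ℕ)).filter
    (fun l => ∀ i : Fin m, ((i : ℕ) + 1) ∣ l i)
  let φ : (Fin m →₀ ℕ) → (Fin m →₀ ℕ) := fun l => Finsupp.equivFunOnFinite.symm
    (fun i => l i / ((i : ℕ) + 1))
  have hφ : Set.InjOn φ T := by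
    intro a ha b hb hab
    ext i
    have h1 := DFunLike.congr_fun hab i
    simp only [φ, Finsupp.equivFunOnFinite_symm_apply_apply] at h1
    exact Nat.div_left_inj ((Finset.mem_filter.1 ha).2 i) ((Finset.mem_filter.1 hb).2 i) |>.1 h1
  refine ⟨T.image φ, ?_, ?_⟩
  · ext μ
    simp only [Finset.coe_image, Set.mem_image, Finset.mem_coe, Set.mem_ofPred_eq]
    constructor
    · rintro ⟨l, hl, rfl⟩
      obtain ⟨h1, h2⟩ := Finset.mem_filter.1 hl
      rw [Finset.mem_finsuppAntidiag] at h1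
      rw [Finsupp.weight_apply, Finsupp.sum_fintype _ _ (by simp), ← h1.1]
      refine Finset.sum_congr rfl fun i _ => ?_
      simp [φ, Nat.div_mul_cancel (h2 i)]
    · intro h
      refine ⟨Finsupp.equivFunOnFinite.symm (fun i => μ i * ((i : ℕ) + 1)), ?_, ?_⟩
      · refine Finset.mem_filter.2 ⟨?_, by simp⟩
        rw [Finset.mem_finsuppAntidiag]
        rw [Finsupp.weight_apply, Finsupp.sum_fintype _ _ (by simp)] at h
        exact ⟨by simpa using h, by simp⟩
      · ext i
        simp [φ]
  · rw [Finset.card_image_of_injOn hφ, qPoch_inv_eq_prod, PowerSeries.coeff_prod]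
    simp only [PowerSeries.coeff_mk, Finset.prod_ite_zero, Finset.prod_const_one]
    simp [T]

/-- The algebra endomorphism multiplying the variable `i` by `2 ^ w i`. -/
noncomputable def scaleBy {σ : Type*} (w : σ → ℕ) : MvPolynomial σ ℂ →ₐ[ℂ] MvPolynomial σ ℂ :=
  aeval (fun i => C (2 ^ w i) * X i)

lemma coeff_scaleBy {σ : Type*} (w : σ → ℕ) (f : MvPolynomial σ ℂ) (μ : σ →₀ ℕ) :
    coeff μ (scaleBy w f) = 2 ^ Finsupp.weight w μ * coeff μ f := by
  classical
  induction f using MvPolynomial.induction_on' with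
  | monomial ν a =>
    have : scaleBy w (monomial ν a) = monomial ν (2 ^ Finsupp.weight w ν * a) := by
      rw [scaleBy, aeval_monomial]
      simp only [mul_pow, Finsupp.prod_mul, algebraMap_eq, ← C_pow, ← pow_mul]
      rw [MvPolynomial.monomial_eq, C_mul, Finsupp.weight_apply, Finsupp.sum, Finsupp.prod,
        ← Finset.prod_pow_eq_pow_sum, map_prod]
      simp only [smul_eq_mul, mul_comm (w _)]
      ring
    rw [this, coeff_monomial, coeff_monomial]
    split_ifs with h
    · rw [h]
    · simp
  | add p q hp hq => rw [map_add, coeff_add, hp, hq, coeff_add, mul_add]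

lemma pow_smul_scaleBy_eq_iff {σ : Type*} (w : σ → ℕ) (s d : ℕ) (f : MvPolynomial σ ℂ) :
    (2 ^ s : ℂ) • scaleBy w f = (2 ^ d : ℂ) • f ↔
      ∀ μ, coeff μ f ≠ 0 → s + Finsupp.weight w μ = d := by
  rw [MvPolynomial.ext_iff]
  refine forall_congr' fun μ => ?_
  rw [coeff_smul, coeff_smul, coeff_scaleBy, smul_eq_mul, smul_eq_mul, ← mul_assoc, ← pow_add]
  constructor
  · intro h h0
    have := mul_right_cancel₀ h0 h
    exact Nat.pow_right_injective le_rfl (by exact_mod_cast this)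
  · intro h
    by_cases h0 : coeff μ f = 0
    · simp [h0]
    · rw [h h0]

lemma isHomogeneous_iff_scaleBy {σ : Type*} (d : ℕ) (f : MvPolynomial σ ℂ) :
    f.IsHomogeneous d ↔ scaleBy (fun _ => 1) f = (2 ^ d : ℂ) • f := by
  have := pow_smul_scaleBy_eq_iff (fun _ : σ => 1) 0 d f
  rw [pow_zero, one_smul] at this
  rw [this]
  simp only [zero_add]
  rfl

/-- Symmetric polynomials `f` in `m` variables such that `q ^ s * f` is homogeneous of degree `d`
for a variable `q` of degree one; homogeneity is expressed through scaling by `2`. -/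
noncomputable def symHom (m s d : ℕ) : Submodule ℂ (MvPolynomial (Fin m) ℂ) where
  carrier := {f | f.IsSymmetric ∧
    (2 ^ s : ℂ) • scaleBy (fun _ => 1) f = (2 ^ d : ℂ) • f}
  add_mem' ha hb := ⟨ha.1.add hb.1, by rw [map_add, smul_add, ha.2, hb.2, smul_add]⟩
  zero_mem' := ⟨IsSymmetric.zero, by simp⟩
  smul_mem' c f hf := ⟨hf.1.smul c, by rw [map_smul, smul_comm, hf.2, smul_comm]⟩

lemma scaleBy_esymm (m k : ℕ) :
    scaleBy (fun _ => 1) (esymm (Fin m) ℂ k) = C (2 ^ k) * esymm (Fin m) ℂ k := by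
  simp only [esymm, map_sum, map_prod, Finset.mul_sum]
  refine Finset.sum_congr rfl fun t ht => ?_
  simp [scaleBy, Finset.prod_mul_distrib, (Finset.mem_powersetCard.1 ht).2]

lemma scaleBy_aeval_esymm (m : ℕ) (P : MvPolynomial (Fin m) ℂ) :
    scaleBy (fun _ => 1) (aeval (fun i : Fin m => esymm (Fin m) ℂ (i + 1)) P) =
      aeval (fun i : Fin m => esymm (Fin m) ℂ (i + 1)) (scaleBy (fun i : Fin m => (i : ℕ) + 1) P) := by
  induction P using MvPolynomial.induction_on with
  | C a => simp only [scaleBy, aeval_C, algebraMap_eq]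
  | add p q hp hq => simp only [map_add, hp, hq]
  | mul_X p i hp =>
    rw [map_mul, map_mul, hp, map_mul, map_mul, aeval_X, scaleBy_esymm]
    congr 1
    rw [scaleBy, aeval_X, map_mul, aeval_X, aeval_C, algebraMap_eq]

lemma aeval_esymm_injective (m : ℕ) :
    Function.Injective (aeval (R := ℂ) (fun i : Fin m => esymm (Fin m) ℂ (i + 1))) := by
  intro a b h
  refine esymmAlgHom_injective ℂ (Fintype.card_fin m).ge (Subtype.ext ?_)
  rwa [esymmAlgHom_apply, esymmAlgHom_apply]

lemma exists_aeval_esymm_eq {m : ℕ} {f : MvPolynomial (Fin m) ℂ} (hf : f.IsSymmetric) :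
    ∃ P, aeval (R := ℂ) (fun i : Fin m => esymm (Fin m) ℂ (i + 1)) P = f := by
  obtain ⟨P, hP⟩ := (esymmAlgEquiv (Fin m) ℂ (Fintype.card_fin m)).surjective ⟨f, hf⟩
  exact ⟨P, by rw [← esymmAlgHom_apply]; exact congrArg Subtype.val hP⟩

lemma symHom_eq_map (m s d : ℕ) :
    symHom m s d = (restrictSupport ℂ {μ : Fin m →₀ ℕ |
        s + Finsupp.weight (fun i : Fin m => (i : ℕ) + 1) μ = d}).map
      (aeval (R := ℂ) (fun i : Fin m => esymm (Fin m) ℂ (i + 1))).toLinearMap := by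
  have key (P : MvPolynomial (Fin m) ℂ) : P ∈ restrictSupport ℂ {μ : Fin m →₀ ℕ |
        s + Finsupp.weight (fun i : Fin m => (i : ℕ) + 1) μ = d} ↔
      (2 ^ s : ℂ) • scaleBy (fun i : Fin m => (i : ℕ) + 1) P = (2 ^ d : ℂ) • P := by
    rw [pow_smul_scaleBy_eq_iff, mem_restrictSupport_iff]
    simp [Set.subset_def]
  ext f
  simp only [Submodule.mem_map, key, AlgHom.toLinearMap_apply]
  constructor
  · rintro ⟨h1, h2⟩
    obtain ⟨P, rfl⟩ := exists_aeval_esymm_eq h1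
    refine ⟨P, ?_, rfl⟩
    apply aeval_esymm_injective
    rw [map_smul, map_smul, ← scaleBy_aeval_esymm, h2]
  · rintro ⟨P, hP, rfl⟩
    refine ⟨?_, by rw [scaleBy_aeval_esymm, ← map_smul, hP, map_smul]⟩
    rw [← esymmAlgHom_apply]
    exact ((esymmAlgHom (Fin m) ℂ m) P).2

lemma finrank_symHom (m s d : ℕ) :
    FiniteDimensional ℂ (symHom m s d) ∧
      (Module.finrank ℂ (symHom m s d) : ℚ) =
        PowerSeries.coeff d (PowerSeries.X ^ s * (qPoch m)⁻¹) := by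
  set A : Set (Fin m →₀ ℕ) :=
    {μ | s + Finsupp.weight (fun i : Fin m => (i : ℕ) + 1) μ = d} with hA
  obtain ⟨S, hS, hc⟩ : ∃ S : Finset (Fin m →₀ ℕ), (S : Set (Fin m →₀ ℕ)) = A ∧
      PowerSeries.coeff d (PowerSeries.X ^ s * (qPoch m)⁻¹) = (S.card : ℚ) := by
    rw [PowerSeries.coeff_X_pow_mul']
    split_ifs with h
    · obtain ⟨S, h1, h2⟩ := exists_finset_weightSet m (d - s)
      refine ⟨S, ?_, h2⟩
      rw [h1, hA]
      ext μ
      simp only [Set.mem_ofPred_eq]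
      omega
    · refine ⟨∅, ?_, by simp⟩
      rw [hA]
      ext μ
      simp only [Finset.coe_empty, Set.mem_empty_iff_false, Set.mem_ofPred_eq, false_iff]
      omega
  have e := Submodule.equivMapOfInjective
    (aeval (R := ℂ) (fun i : Fin m => esymm (Fin m) ℂ (i + 1))).toLinearMap
    (aeval_esymm_injective m) (restrictSupport ℂ A)
  rw [← symHom_eq_map] at e
  have b := (basisRestrictSupport ℂ A).map e
  rw [← hS] at b
  refine ⟨b.finiteDimensional_of_finite, ?_⟩
  rw [Module.finrank_eq_card_basis b, hc]
  simp

/-- Polynomials in an extra variable `x` with symmetric coefficients such that `q ^ s * h` is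
homogeneous of total degree `d` for a variable `q` of degree one. -/
noncomputable def polySymHom (m s d : ℕ) :
    Submodule ℂ (Polynomial (MvPolynomial (Fin m) ℂ)) where
  carrier := {h | ∀ k, h.coeff k ∈ symHom m (s + k) d}
  add_mem' ha hb k := by
    rw [Polynomial.coeff_add]
    exact add_mem (ha k) (hb k)
  zero_mem' k := by simp
  smul_mem' c f hf k := by
    rw [Polynomial.coeff_smul]
    exact Submodule.smul_mem _ c (hf k)

lemma eq_zero_of_mem_symHom {m s d : ℕ} (h : d < s) {f : MvPolynomial (Fin m) ℂ}
    (hf : f ∈ symHom m s d) : f = 0 := by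
  ext μ
  by_contra h0
  have := (pow_smul_scaleBy_eq_iff _ s d f).1 hf.2 μ (by simpa using h0)
  omega

/-- The coefficients of an element of `polySymHom`. -/
noncomputable def polySymHomEquiv (m s d : ℕ) :
    polySymHom m s d ≃ₗ[ℂ] ((k : Fin (d + 1)) → symHom m (s + k) d) where
  toFun h k := ⟨h.1.coeff k, h.2 k⟩
  map_add' a b := by
    ext k : 2
    simp
  map_smul' c a := by
    ext k : 2
    simp
  invFun v := ⟨∑ k : Fin (d + 1), Polynomial.monomial (k : ℕ) (v k).1, fun k => by
    rw [Polynomial.finsetSum_coeff]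
    refine Submodule.sum_mem _ fun i _ => ?_
    rw [Polynomial.coeff_monomial]
    split_ifs with h
    · rw [← h]
      exact (v i).2
    · exact zero_mem _⟩
  left_inv h := by
    apply Subtype.ext
    ext1 k
    simp only [Polynomial.finsetSum_coeff, Polynomial.coeff_monomial]
    by_cases hk : k < d + 1
    · rw [Finset.sum_eq_single ⟨k, hk⟩]
      · simp
      · intro b _ hb
        rw [if_neg]
        rintro rfl
        exact hb rfl
      · simp
    · rw [eq_zero_of_mem_symHom (by omega) (h.2 k)]
      refine Finset.sum_eq_zero fun i _ => if_neg ?_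
      have := i.2
      omega
  right_inv v := by
    ext k : 2
    simp only [Polynomial.finsetSum_coeff, Polynomial.coeff_monomial]
    rw [Finset.sum_eq_single k]
    · simp
    · intro b _ hb
      rw [if_neg]
      intro h
      exact hb (Fin.ext h)
    · simp

lemma qPoch_one_inv : (qPoch 1)⁻¹ = PowerSeries.mk (fun _ => (1 : ℚ)) := by
  rw [qPoch_inv_eq_prod]
  simp

lemma finrank_polySymHom (m s d : ℕ) :
    FiniteDimensional ℂ (polySymHom m s d) ∧
      (Module.finrank ℂ (polySymHom m s d) : ℚ) =
        PowerSeries.coeff d (PowerSeries.X ^ s * (qPoch 1 * qPoch m)⁻¹) := by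
  have (k : Fin (d + 1)) : FiniteDimensional ℂ (symHom m (s + k) d) := (finrank_symHom _ _ _).1
  refine ⟨(polySymHomEquiv m s d).symm.finiteDimensional, ?_⟩
  rw [(polySymHomEquiv m s d).finrank_eq, Module.finrank_pi_fintype, Nat.cast_sum]
  simp only [(finrank_symHom _ _ _).2]
  rw [PowerSeries.mul_inv_rev, mul_comm _ (qPoch 1)⁻¹, mul_left_comm, qPoch_one_inv,
    PowerSeries.coeff_mul, Finset.Nat.sum_antidiagonal_eq_sum_range_succ_mk,
    Finset.sum_range]
  refine Finset.sum_congr rfl fun k _ => ?_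
  rw [add_comm s, pow_add, mul_assoc, PowerSeries.coeff_X_pow_mul', if_pos (by omega)]
  simp

lemma X_sub_X_dvd_iff {σ : Type*} [DecidableEq σ] (i j : σ) (f : MvPolynomial σ ℂ) :
    (X j - X i : MvPolynomial σ ℂ) ∣ f ↔
      aeval (R := ℂ) (Function.update (X : σ → MvPolynomial σ ℂ) i (X j)) f = 0 := by
  constructor
  · rintro ⟨q, rfl⟩
    rw [map_mul, map_sub, aeval_X, aeval_X]
    by_cases h : j = i <;> simp [Function.update, h]
  · intro h
    rw [← Ideal.mem_span_singleton, ← Ideal.Quotient.eq_zero_iff_mem]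
    let q := Ideal.Quotient.mkₐ ℂ (Ideal.span {(X j - X i : MvPolynomial σ ℂ)})
    have : q = q.comp (aeval (Function.update (X : σ → MvPolynomial σ ℂ) i (X j))) := by
      apply MvPolynomial.algHom_ext
      intro k
      rw [AlgHom.comp_apply, aeval_X]
      by_cases hk : k = i
      · subst hk
        rw [Function.update_self]
        exact ((Ideal.Quotient.eq).2 (Ideal.mem_span_singleton_self _)).symm
      · rw [Function.update_of_ne hk]
    change q f = 0
    rw [this, AlgHom.comp_apply, h, map_zero]

lemma X_sub_X_ne_zero {σ : Type*} {i j : σ} (h : i ≠ j) : (X j - X i : MvPolynomial σ ℂ) ≠ 0 :=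
  sub_ne_zero.2 fun h' => h (X_injective h').symm

lemma prime_X_sub_X {σ : Type*} {i j : σ} (h : i ≠ j) : Prime (X j - X i : MvPolynomial σ ℂ) := by
  classical
  refine ⟨X_sub_X_ne_zero h, fun hu => ?_, fun a b hab => ?_⟩
  · have := (X_sub_X_dvd_iff i j (1 : MvPolynomial σ ℂ)).1 hu.dvd
    simp at this
  · rw [X_sub_X_dvd_iff] at hab ⊢
    rw [X_sub_X_dvd_iff]
    rwa [map_mul, mul_eq_zero] at hab

lemma isRelPrime_X_sub_X {m : ℕ} {i j k l : Fin m} (h1 : i < j) (h2 : k < l)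
    (hne : ¬(i = k ∧ j = l)) :
    IsRelPrime (X j - X i : MvPolynomial (Fin m) ℂ) (X l - X k) := by
  rw [(prime_X_sub_X h1.ne).irreducible.isRelPrime_iff_not_dvd, X_sub_X_dvd_iff, map_sub, aeval_X,
    aeval_X, sub_eq_zero, Function.update_apply, Function.update_apply]
  intro h
  split_ifs at h <;> have := X_injective h <;> grind

/-- The discriminant `∏_{i < j} (x_j - x_i)²`. -/
noncomputable def discr (m : ℕ) : MvPolynomial (Fin m) ℂ :=
  (Matrix.vandermonde (X : Fin m → MvPolynomial (Fin m) ℂ)).det ^ 2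

lemma discr_ne_zero (m : ℕ) : discr m ≠ 0 :=
  pow_ne_zero _ (Matrix.det_vandermonde_ne_zero_iff.2 X_injective)

lemma aeval_discr {m : ℕ} {B : Type*} [CommRing B] [Algebra ℂ B] (v : Fin m → B) :
    aeval v (discr m) = (Matrix.vandermonde v).det ^ 2 := by
  rw [discr, map_pow, AlgHom.map_det]
  congr 2
  ext i j
  simp [Matrix.vandermonde_apply]

lemma isSymmetric_discr (m : ℕ) : (discr m).IsSymmetric := by
  intro π
  have h : rename π (discr m) = aeval (X ∘ π : Fin m → MvPolynomial (Fin m) ℂ) (discr m) := by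
    rw [← aeval_rename, aeval_X_left_apply]
  rw [h, aeval_discr, discr]
  have : Matrix.vandermonde (X ∘ π : Fin m → MvPolynomial (Fin m) ℂ) =
      (Matrix.vandermonde X).submatrix π id := rfl
  rw [this, Matrix.det_permute, mul_pow]
  rcases Int.units_eq_one_or (Equiv.Perm.sign π) with h | h <;> simp [h]

lemma scaleBy_discr (m : ℕ) :
    scaleBy (fun _ => 1) (discr m) = C (2 ^ (m * (m - 1))) * discr m := by
  rw [scaleBy, aeval_discr, discr]
  have : ∑ i : Fin m, (i : ℕ) = ∑ i ∈ Finset.range m, i :=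
    (Finset.sum_range fun i => i).symm
  have h : Matrix.vandermonde (fun i : Fin m => C (2 ^ 1) * X i : Fin m → MvPolynomial (Fin m) ℂ) =
      Matrix.of fun i j : Fin m => C (2 ^ (j : ℕ)) * Matrix.vandermonde X i j := by
    ext1 i j
    simp [Matrix.vandermonde_apply, mul_pow]
  rw [h, Matrix.det_mul_row (fun j : Fin m => C (2 ^ (j : ℕ))), mul_pow, ← map_prod, ← C_pow, Finset.prod_pow_eq_pow_sum, this,
    ← pow_mul, Finset.sum_range_id_mul_two]

lemma discr_dvd {m : ℕ} {f : MvPolynomial (Fin m) ℂ} (hf : f.IsSymmetric)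
    (h : ∀ i j : Fin m, i ≠ j →
      aeval (R := ℂ) (Function.update (X : Fin m → MvPolynomial (Fin m) ℂ) i (X j)) f = 0) :
    discr m ∣ f := by
  rw [discr, Matrix.det_vandermonde, ← Finset.prod_pow]
  simp only [← Finset.prod_pow]
  rw [Finset.prod_sigma']
  refine Finset.prod_dvd_of_isRelPrime ?_ ?_
  · rintro ⟨i, j⟩ hij ⟨k, l⟩ hkl hne
    simp only [Finset.coe_sigma, Set.mem_sigma_iff, Finset.coe_univ, Set.mem_univ, true_and,
      Finset.coe_Ioi, Set.mem_Ioi] at hij hkl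
    refine (isRelPrime_X_sub_X hij hkl ?_).pow
    rintro ⟨rfl, rfl⟩
    exact hne rfl
  · rintro ⟨i, j⟩ hij
    simp only [Finset.mem_sigma, Finset.mem_univ, Finset.mem_Ioi, true_and] at hij
    obtain ⟨q, hq⟩ := (X_sub_X_dvd_iff i j f).2 (h i j hij.ne)
    have h1 : rename (Equiv.swap i j) q = -q := by
      have h2 := hf (Equiv.swap i j)
      rw [hq, map_mul, map_sub, rename_X, rename_X, Equiv.swap_apply_left,
        Equiv.swap_apply_right] at h2
      refine mul_left_cancel₀ (X_sub_X_ne_zero hij.ne) ?_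
      linear_combination -h2
    have h3 : aeval (R := ℂ) (Function.update (X : Fin m → MvPolynomial (Fin m) ℂ) i (X j))
        (rename (Equiv.swap i j) q) =
        aeval (R := ℂ) (Function.update (X : Fin m → MvPolynomial (Fin m) ℂ) i (X j)) q := by
      rw [aeval_rename]
      congr 2
      funext k
      simp only [Function.comp_apply, Function.update_apply, Equiv.swap_apply_def]
      grind
    rw [h1, map_neg, neg_eq_self, ← X_sub_X_dvd_iff] at h3
    obtain ⟨r, hr⟩ := h3
    exact ⟨r, by rw [hq, hr]; ring⟩

lemma aeval_comp_perm {n : ℕ} {B : Type*} [CommRing B] [Algebra ℂ B]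
    {f : MvPolynomial (Fin n) ℂ} (hf : f.IsSymmetric) (g : Fin n → B) (π : Equiv.Perm (Fin n)) :
    aeval (g ∘ π) f = aeval g f := by
  rw [← aeval_rename, hf π]

lemma exists_perm_apply_eq {p n : ℕ} (a b : Fin p ↪ Fin n) :
    ∃ π : Equiv.Perm (Fin n), ∀ i, π (a i) = b i := by
  obtain ⟨π, hπ⟩ := (Equiv.Perm.isMultiplyPretransitive (Fin n) p).exists_smul_eq a b
  exact ⟨π, fun i => DFunLike.congr_fun hπ i⟩

/-- Substitution of a single variable `x` for the first block of variables. -/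
noncomputable def blockSub {n p m : ℕ} (e : Fin n ≃ Fin p ⊕ Fin m) :
    MvPolynomial (Fin n) ℂ →ₐ[ℂ] Polynomial (MvPolynomial (Fin m) ℂ) :=
  aeval fun i => Sum.elim (fun _ => Polynomial.X) (fun j => Polynomial.C (X j)) (e i)

lemma aeval_eq_zero_of_blockSub_eq_zero {n p m : ℕ} (e : Fin n ≃ Fin p ⊕ Fin m)
    {f : MvPolynomial (Fin n) ℂ} (hf : f.IsSymmetric) (h : blockSub e f = 0)
    {B : Type*} [CommRing B] [Algebra ℂ B] (g : Fin n → B) (t : Fin p ↪ Fin n) (b : B)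
    (hb : ∀ i, g (t i) = b) : aeval g f = 0 := by
  obtain ⟨π, hπ⟩ := exists_perm_apply_eq
    ((Function.Embedding.inl (α := Fin p) (β := Fin m)).trans e.symm.toEmbedding) t
  rw [← aeval_comp_perm hf g π]
  let ψ : Polynomial (MvPolynomial (Fin m) ℂ) →ₐ[ℂ] B :=
    Polynomial.eval₂AlgHom (aeval fun j => g (π (e.symm (Sum.inr j)))) b fun _ => mul_comm _ _
  have hψ (x) : ψ x =
      x.eval₂ (aeval fun j => g (π (e.symm (Sum.inr j))) : MvPolynomial (Fin m) ℂ →ₐ[ℂ] B) b := rfl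
  have : aeval (g ∘ π) = ψ.comp (blockSub e) := by
    apply MvPolynomial.algHom_ext
    intro i
    rw [AlgHom.comp_apply, blockSub, aeval_X, aeval_X]
    obtain ⟨x, rfl⟩ := e.symm.surjective i
    rw [Equiv.apply_symm_apply]
    rcases x with i | j
    · have := hπ i
      simp only [Function.Embedding.trans_apply, Function.Embedding.inl_apply,
        Equiv.coe_toEmbedding] at this
      simp [hψ, this, hb]
    · simp [hψ]
  rw [this, AlgHom.comp_apply, h, map_zero]

/-- A polynomial vanishing whenever two disjoint pairs of variables coincide. -/
def VanishesOnPairs {n : ℕ} (f : MvPolynomial (Fin n) ℂ) : Prop :=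
  ∀ {B : Type} [CommRing B] [Algebra ℂ B] (g : Fin n → B) (t : Fin 4 ↪ Fin n),
    g (t 0) = g (t 1) → g (t 2) = g (t 3) → aeval g f = 0

/-- A polynomial vanishing whenever `p` variables coincide. -/
def VanishesOnBlocks {n : ℕ} (p : ℕ) (f : MvPolynomial (Fin n) ℂ) : Prop :=
  ∀ {B : Type} [CommRing B] [Algebra ℂ B] (g : Fin n → B) (t : Fin p ↪ Fin n) (b : B),
    (∀ i, g (t i) = b) → aeval g f = 0

lemma vanishesOnPairs_iff {n : ℕ} (hn : 4 ≤ n) {f : MvPolynomial (Fin n) ℂ}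
    (hf : f.IsSymmetric) :
    VanishesOnPairs f ↔ aeval (R := ℂ)
      (fun i : Fin n => if (i : ℕ) = 1 then X (⟨0, by omega⟩ : Fin n)
        else if (i : ℕ) = 3 then X (⟨2, by omega⟩ : Fin n)
        else (X i : MvPolynomial (Fin n) ℂ)) f = 0 := by
  constructor
  · intro h
    exact h _ (Fin.castLEEmb hn) (by simp [Fin.ext_iff]) (by simp [Fin.ext_iff])
  · intro h B _ _ g t h1 h2
    obtain ⟨π, hπ⟩ := exists_perm_apply_eq (Fin.castLEEmb hn) t
    rw [← aeval_comp_perm hf g π]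
    have : aeval (g ∘ π) = (aeval (g ∘ π)).comp (aeval (R := ℂ)
      (fun i : Fin n => if (i : ℕ) = 1 then X (⟨0, by omega⟩ : Fin n)
        else if (i : ℕ) = 3 then X (⟨2, by omega⟩ : Fin n)
        else (X i : MvPolynomial (Fin n) ℂ))) := by
      apply MvPolynomial.algHom_ext
      intro i
      rw [AlgHom.comp_apply, aeval_X, aeval_X]
      have e0 : (⟨0, by omega⟩ : Fin n) = Fin.castLEEmb hn 0 := Fin.ext rfl
      have e2 : (⟨2, by omega⟩ : Fin n) = Fin.castLEEmb hn 2 := Fin.ext rfl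
      split_ifs with h3 h4
      · have e1 : i = Fin.castLEEmb hn 1 := Fin.ext h3
        rw [aeval_X, e0, e1, Function.comp_apply, Function.comp_apply, hπ, hπ, h1]
      · have e1 : i = Fin.castLEEmb hn 3 := Fin.ext h4
        rw [aeval_X, e2, e1, Function.comp_apply, Function.comp_apply, hπ, hπ, h2]
      · rw [aeval_X]
    rw [this, AlgHom.comp_apply, h, map_zero]

lemma derivative_aeval {n : ℕ} {B : Type*} [CommRing B] [Algebra ℂ B]
    (g : Fin n → Polynomial B) (f : MvPolynomial (Fin n) ℂ) :
    Polynomial.derivative (aeval g f) =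
      ∑ i, aeval g (pderiv i f) * Polynomial.derivative (g i) := by
  induction f using MvPolynomial.induction_on with
  | C a =>
    rw [aeval_C, Polynomial.algebraMap_apply, Polynomial.derivative_C]
    simp only [pderiv_C, map_zero, zero_mul, Finset.sum_const_zero]
  | add p q hp hq => simp [hp, hq, add_mul, Finset.sum_add_distrib]
  | mul_X p k hp =>
    rw [map_mul, Polynomial.derivative_mul, hp, aeval_X]
    simp only [Derivation.leibniz, smul_eq_mul, map_add, map_mul, aeval_X, add_mul,
      Finset.sum_add_distrib, pderiv_X]
    rw [add_comm, Finset.sum_mul]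
    refine congrArg₂ (· + ·) ?_ ?_
    · rw [Finset.sum_eq_single k]
      · simp
      · intro b _ hb
        simp [hb.symm]
      · simp
    · exact Finset.sum_congr rfl fun i _ => by ring

/-- The affine line `x ↦ c + x v`. -/
noncomputable def affineLine {n : ℕ} {B : Type*} [CommRing B] (c v : Fin n → B) (i : Fin n) :
    Polynomial B :=
  Polynomial.C (c i) + Polynomial.C (v i) * Polynomial.X

section

variable {n : ℕ} {B : Type*} [CommRing B] [Algebra ℂ B]

lemma eval_aeval_affineLine (c v : Fin n → B) (b : B) (f : MvPolynomial (Fin n) ℂ) :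
    (aeval (affineLine c v) f).eval b = aeval (fun i => c i + v i * b) f := by
  have : (aeval (affineLine c v) f).eval b =
    ((Polynomial.aeval (R := B) b).restrictScalars ℂ) (aeval (affineLine c v) f) := by
    rw [AlgHom.restrictScalars_apply, Polynomial.coe_aeval_eq_eval]
  rw [this, ← AlgHom.comp_apply, comp_aeval]
  congr 2
  funext i
  simp [affineLine]

lemma derivative_aeval_affineLine (c v : Fin n → B) (f : MvPolynomial (Fin n) ℂ) :
    Polynomial.derivative (aeval (affineLine c v) f) =
      ∑ i, aeval (affineLine c v) (pderiv i f) * Polynomial.C (v i) := by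
  rw [derivative_aeval]
  simp [affineLine]

lemma eval_derivative_affineLine (c v : Fin n → B) (b : B) (f : MvPolynomial (Fin n) ℂ) :
    (Polynomial.derivative (aeval (affineLine c v) f)).eval b =
      ∑ i, aeval (fun i => c i + v i * b) (pderiv i f) * v i := by
  simp [derivative_aeval_affineLine, Polynomial.eval_finsetSum, eval_aeval_affineLine]

lemma eval_derivative_derivative_affineLine (c v : Fin n → B) (b : B)
    (f : MvPolynomial (Fin n) ℂ) :
    (Polynomial.derivative (Polynomial.derivative (aeval (affineLine c v) f))).eval b =
      ∑ i, ∑ j, aeval (fun i => c i + v i * b) (pderiv j (pderiv i f)) * v j * v i := by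
  simp [derivative_aeval_affineLine, Polynomial.eval_finsetSum, eval_aeval_affineLine,
    Finset.sum_mul]

lemma aeval_pderiv_perm {f : MvPolynomial (Fin n) ℂ} (hf : f.IsSymmetric) {g : Fin n → B}
    {π : Equiv.Perm (Fin n)} (hg : g ∘ π = g) (i : Fin n) :
    aeval g (pderiv (π i) f) = aeval g (pderiv i f) := by
  conv_lhs => rw [← hf π, pderiv_rename π.injective, aeval_rename, hg]

lemma aeval_pderiv_pderiv_perm {f : MvPolynomial (Fin n) ℂ} (hf : f.IsSymmetric) {g : Fin n → B}
    {π : Equiv.Perm (Fin n)} (hg : g ∘ π = g) (i j : Fin n) :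
    aeval g (pderiv (π j) (pderiv (π i) f)) = aeval g (pderiv j (pderiv i f)) := by
  conv_lhs =>
    rw [← hf π, pderiv_rename π.injective, pderiv_rename π.injective, aeval_rename, hg]

lemma comp_swap_eq_self {α β : Type*} [DecidableEq α] {g : α → β} {a b : α} (h : g a = g b) :
    g ∘ Equiv.swap a b = g := by
  funext i
  simp only [Function.comp_apply, Equiv.swap_apply_def]
  grind

end

lemma aeval_pderiv_eq_zero_of_vanishesOnBlocks {n : ℕ} {B : Type} [CommRing B] [Algebra ℂ B]
    [IsDomain B] [CharZero B] {f : MvPolynomial (Fin n) ℂ} (hf : f.IsSymmetric)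
    (h : VanishesOnBlocks 3 f) {g : Fin n → B} (t : Fin 3 ↪ Fin n) (b : B)
    (hb : ∀ i, g (t i) = b) (k : Fin 3) : aeval g (pderiv (t k) f) = 0 := by
  let v : Fin n → B := fun i => ∑ k, (Pi.single (t k) 1 : Fin n → B) i
  have hv (l : Fin 3) : v (t l) = 1 := by
    simp only [v, Pi.single_apply, t.injective.eq_iff]
    simp
  have h0 : aeval (affineLine g v) f = 0 :=
    h _ t (Polynomial.C b + Polynomial.X) fun l => by simp [affineLine, hv, hb]
  have h1 := eval_derivative_affineLine g v 0 f
  have h2 (l : Fin 3) : aeval g (pderiv (t l) f) = aeval g (pderiv (t k) f) := by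
    have := aeval_pderiv_perm hf (comp_swap_eq_self ((hb k).trans (hb l).symm)) (t k)
    rwa [Equiv.swap_apply_left] at this
  simp only [h0, map_zero, Polynomial.eval_zero, mul_zero, add_zero, v, Finset.mul_sum] at h1
  rw [Finset.sum_comm] at h1
  simp only [Pi.single_apply, mul_ite, mul_one, mul_zero, Finset.sum_ite_eq',
    Finset.mem_univ, if_true, h2] at h1
  simpa using h1.symm

lemma aeval_pderiv_eq_zero_of_vanishesOnPairs {n : ℕ} {B : Type} [CommRing B] [Algebra ℂ B]
    [IsDomain B] [CharZero B] {f : MvPolynomial (Fin n) ℂ} (hf : f.IsSymmetric)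
    (h : VanishesOnPairs f) {g : Fin n → B} (t : Fin 4 ↪ Fin n) (b : B)
    (hb : ∀ i, g (t i) = b)
    (k : Fin 4) : aeval g (pderiv (t k) f) = 0 := by
  have h2 (l : Fin 4) : aeval g (pderiv (t l) f) = aeval g (pderiv (t k) f) := by
    have := aeval_pderiv_perm hf (comp_swap_eq_self ((hb k).trans (hb l).symm)) (t k)
    rwa [Equiv.swap_apply_left] at this
  let v : Fin n → B := Pi.single (t 2) 1 + Pi.single (t 3) 1
  have h0 : aeval (affineLine g v) f = 0 :=
    h _ t (by simp [affineLine, v, hb])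
      (by simp [affineLine, v, hb])
  have h1 := eval_derivative_affineLine g v 0 f
  simp only [h0, map_zero, Polynomial.eval_zero, mul_zero, add_zero, v, Pi.add_apply, mul_add,
    Finset.sum_add_distrib] at h1
  simp only [Pi.single_apply, mul_ite, mul_one, mul_zero, Finset.sum_ite_eq',
    Finset.mem_univ, if_true, h2] at h1
  have : 2 * aeval g (pderiv (t k) f) = 0 := by linear_combination -h1
  simpa using this

lemma aeval_pderiv_pderiv_eq_zero_aux {n : ℕ} {B : Type} [CommRing B] [Algebra ℂ B]
    [IsDomain B] [CharZero B] {f : MvPolynomial (Fin n) ℂ} (hf : f.IsSymmetric)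
    (h : VanishesOnPairs f) {g : Fin n → B} (t : Fin 4 ↪ Fin n) (b : B)
    (hb : ∀ i, g (t i) = b) :
    aeval g (pderiv (t 0) (pderiv (t 0) f)) = 0 ∧ aeval g (pderiv (t 1) (pderiv (t 0) f)) = 0 := by
  set H : Fin 4 → Fin 4 → B := fun k l => aeval g (pderiv (t l) (pderiv (t k) f)) with hH
  have key (π : Equiv.Perm (Fin 4)) (k l : Fin 4) : H (π k) (π l) = H k l := by
    have hg : g ∘ (π.viaFintypeEmbedding t) = g := by
      funext i
      by_cases hi : i ∈ Set.range t
      · obtain ⟨l, rfl⟩ := hi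
        rw [Function.comp_apply, Equiv.Perm.viaFintypeEmbedding_apply_image, hb, hb]
      · rw [Function.comp_apply, Equiv.Perm.viaFintypeEmbedding_apply_notMem_range _ _ hi]
    have := aeval_pderiv_pderiv_perm hf hg (t k) (t l)
    rwa [Equiv.Perm.viaFintypeEmbedding_apply_image,
      Equiv.Perm.viaFintypeEmbedding_apply_image] at this
  have hd (k : Fin 4) : H k k = H 0 0 := by
    have := key (Equiv.swap 0 k) 0 0
    rwa [Equiv.swap_apply_left] at this
  have ho (k l : Fin 4) (hkl : k ≠ l) : H k l = H 0 1 := by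
    have : ∀ k l : Fin 4, k ≠ l → ∃ π : Equiv.Perm (Fin 4), π 0 = k ∧ π 1 = l := by decide
    obtain ⟨π, rfl, rfl⟩ := this k l hkl
    exact key π 0 1
  have quad (w : Fin 4 → B) (h1 : w 0 = w 1) (h2 : w 2 = w 3) :
      ∑ k, ∑ l, H k l * w l * w k = 0 := by
    let v : Fin n → B := fun i => ∑ k, w k * (Pi.single (t k) 1 : Fin n → B) i
    have hv (l : Fin 4) : v (t l) = w l := by
      simp [v, Pi.single_apply]
    have h0 : aeval (affineLine g v) f = 0 :=
      h _ t (by simp [affineLine, hv, hb, h1]) (by simp [affineLine, hv, hb, h2])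
    have h1 := eval_derivative_derivative_affineLine g v 0 f
    have hs (G : Fin n → B) : ∑ i, G i * v i = ∑ k, G (t k) * w k := by
      simp only [v, Finset.mul_sum]
      rw [Finset.sum_comm]
      simp [Pi.single_apply]
    simp only [h0, map_zero, Polynomial.eval_zero, mul_zero, add_zero, ← Finset.sum_mul, hs] at h1
    rw [h1]
    simp only [Finset.sum_mul, hH]
  have q1 := quad ![0, 0, 1, 1] rfl rfl
  have q2 := quad ![1, 1, -1, -1] rfl rfl
  simp only [Fin.sum_univ_four] at q1 q2
  simp [hd, ho] at q1 q2
  have e1 : 8 * H 0 0 = 0 := by linear_combination 2 * q1 + q2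
  have e2 : 8 * H 0 1 = 0 := by linear_combination 2 * q1 - q2
  exact ⟨by simpa using e1, by simpa using e2⟩

lemma aeval_pderiv_pderiv_eq_zero_of_vanishesOnPairs {n : ℕ} {B : Type} [CommRing B] [Algebra ℂ B]
    [IsDomain B] [CharZero B] {f : MvPolynomial (Fin n) ℂ} (hf : f.IsSymmetric)
    (h : VanishesOnPairs f) {g : Fin n → B} (t : Fin 4 ↪ Fin n) (b : B)
    (hb : ∀ i, g (t i) = b)
    (k l : Fin 4) : aeval g (pderiv (t l) (pderiv (t k) f)) = 0 := by
  have key : ∀ k : Fin 4, ∃ π : Equiv.Perm (Fin 4), π 0 = k := by decide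
  have key' : ∀ k l : Fin 4, k ≠ l → ∃ π : Equiv.Perm (Fin 4), π 0 = k ∧ π 1 = l := by decide
  by_cases hkl : k = l
  · subst hkl
    obtain ⟨π, rfl⟩ := key k
    exact (aeval_pderiv_pderiv_eq_zero_aux hf h (π.toEmbedding.trans t) b fun i => hb _).1
  · obtain ⟨π, rfl, rfl⟩ := key' k l hkl
    exact (aeval_pderiv_pderiv_eq_zero_aux hf h (π.toEmbedding.trans t) b fun i => hb _).2

lemma blockSub_eq_aeval_affineLine {n p m : ℕ} (e : Fin n ≃ Fin p ⊕ Fin m)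
    (f : MvPolynomial (Fin n) ℂ) :
    blockSub e f = aeval (affineLine (fun i => Sum.elim (fun _ => 0) X (e i))
      (fun i => Sum.elim (fun _ => 1) (fun _ => 0) (e i))) f := by
  rw [blockSub]
  congr 2
  funext i
  rcases h : e i with k | j <;> simp [affineLine, h]

/-- The positions of the first block together with one position of the second block. -/
def blockEmb {n p m : ℕ} (e : Fin n ≃ Fin p ⊕ Fin m) (j : Fin m) : Fin (p + 1) ↪ Fin n where
  toFun k := e.symm (Fin.lastCases (motive := fun _ => Fin p ⊕ Fin m) (Sum.inr j) Sum.inl k)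
  inj' k l h := by
    have := e.symm.injective h
    induction k using Fin.lastCases <;> induction l using Fin.lastCases <;> simp_all

section

variable {n p m : ℕ} (e : Fin n ≃ Fin p ⊕ Fin m) (f : MvPolynomial (Fin n) ℂ) (j : Fin m)

lemma blockEmb_castSucc (k : Fin p) : blockEmb e j k.castSucc = e.symm (Sum.inl k) :=
  congrArg e.symm (Fin.lastCases_castSucc (motive := fun _ => Fin p ⊕ Fin m) k)

lemma blockEmb_last : blockEmb e j (Fin.last p) = e.symm (Sum.inr j) :=
  congrArg e.symm (Fin.lastCases_last (motive := fun _ => Fin p ⊕ Fin m))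

/-- The point at which the variable of the first block takes the value `X j`. -/
noncomputable def blockPoint (i : Fin n) : MvPolynomial (Fin m) ℂ :=
  Sum.elim (fun _ => 0) X (e i) + Sum.elim (fun _ => 1) (fun _ => 0) (e i) * X j

lemma blockPoint_blockEmb (k : Fin (p + 1)) : blockPoint e j (blockEmb e j k) = X j := by
  induction k using Fin.lastCases <;>
    simp [blockPoint, blockEmb_castSucc, blockEmb_last]

lemma eval_blockSub : (blockSub e f).eval (X j) = aeval (blockPoint e j) f := by
  rw [blockSub_eq_aeval_affineLine, eval_aeval_affineLine]
  rfl

lemma eval_derivative_blockSub_eq_zero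
    (h : ∀ k, aeval (blockPoint e j) (pderiv (blockEmb e j k) f) = 0) :
    (Polynomial.derivative (blockSub e f)).eval (X j) = 0 := by
  rw [blockSub_eq_aeval_affineLine, eval_derivative_affineLine]
  refine Finset.sum_eq_zero fun i _ => ?_
  obtain ⟨x, rfl⟩ := e.symm.surjective i
  rcases x with k | k
  · have := h k.castSucc
    rw [blockEmb_castSucc] at this
    exact mul_eq_zero_of_left this _
  · simp

lemma eval_derivative_derivative_blockSub_eq_zero
    (h : ∀ k l, aeval (blockPoint e j)
      (pderiv (blockEmb e j l) (pderiv (blockEmb e j k) f)) = 0) :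
    (Polynomial.derivative (Polynomial.derivative (blockSub e f))).eval (X j) = 0 := by
  rw [blockSub_eq_aeval_affineLine, eval_derivative_derivative_affineLine]
  refine Finset.sum_eq_zero fun i _ => Finset.sum_eq_zero fun i' _ => ?_
  obtain ⟨x, rfl⟩ := e.symm.surjective i
  obtain ⟨y, rfl⟩ := e.symm.surjective i'
  rcases x with k | k
  · rcases y with l | l
    · have := h k.castSucc l.castSucc
      rw [blockEmb_castSucc, blockEmb_castSucc] at this
      exact mul_eq_zero_of_left (mul_eq_zero_of_left this _) _
    · simp
  · simp

end

lemma X_sub_C_pow_dvd_of_derivative {m p : ℕ} {F : Polynomial (MvPolynomial (Fin m) ℂ)}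
    {a : MvPolynomial (Fin m) ℂ} (h : ∀ r < p, (Polynomial.derivative^[r] F).eval a = 0) :
    (Polynomial.X - Polynomial.C a) ^ p ∣ F := by
  by_cases hF : F = 0
  · simp [hF]
  rw [← Polynomial.le_rootMultiplicity_iff hF]
  rcases p with _ | p
  · simp
  · exact (Polynomial.lt_rootMultiplicity_iff_isRoot_iterate_derivative hF).2
      fun r hr => h r (by omega)

lemma X_sub_C_sq_dvd_blockSub {n m : ℕ} (e : Fin n ≃ Fin 2 ⊕ Fin m)
    {f : MvPolynomial (Fin n) ℂ} (hf : f.IsSymmetric) (h : VanishesOnBlocks 3 f) (j : Fin m) :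
    (Polynomial.X - Polynomial.C (X j)) ^ 2 ∣ blockSub e f := by
  refine X_sub_C_pow_dvd_of_derivative fun r hr => ?_
  interval_cases r
  · rw [Function.iterate_zero_apply, eval_blockSub]
    exact h _ (blockEmb e j) _ (blockPoint_blockEmb e j)
  · rw [Function.iterate_one]
    exact eval_derivative_blockSub_eq_zero e f j fun k =>
      aeval_pderiv_eq_zero_of_vanishesOnBlocks hf h (blockEmb e j) _ (blockPoint_blockEmb e j) k

lemma X_sub_C_cube_dvd_blockSub {n m : ℕ} (e : Fin n ≃ Fin 3 ⊕ Fin m)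
    {f : MvPolynomial (Fin n) ℂ} (hf : f.IsSymmetric) (h : VanishesOnPairs f) (j : Fin m) :
    (Polynomial.X - Polynomial.C (X j)) ^ 3 ∣ blockSub e f := by
  have hb := blockPoint_blockEmb e j
  refine X_sub_C_pow_dvd_of_derivative fun r hr => ?_
  interval_cases r
  · rw [Function.iterate_zero_apply, eval_blockSub]
    exact h _ (blockEmb e j) ((hb 0).trans (hb 1).symm) ((hb 2).trans (hb 3).symm)
  · rw [Function.iterate_one]
    exact eval_derivative_blockSub_eq_zero e f j fun k =>
      aeval_pderiv_eq_zero_of_vanishesOnPairs hf h (blockEmb e j) _ hb k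
  · rw [Function.iterate_succ_apply, Function.iterate_one]
    exact eval_derivative_derivative_blockSub_eq_zero e f j fun k l =>
      aeval_pderiv_pderiv_eq_zero_of_vanishesOnPairs hf h (blockEmb e j) _ hb k l

/-- Multiplication of all the variables by `2`. -/
noncomputable def scalePoly (m : ℕ) :
    Polynomial (MvPolynomial (Fin m) ℂ) →ₐ[ℂ] Polynomial (MvPolynomial (Fin m) ℂ) :=
  Polynomial.eval₂AlgHom (Polynomial.CAlgHom.comp (scaleBy fun _ => 1))
    (Polynomial.C (C 2) * Polynomial.X) fun _ => mul_comm _ _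

lemma scalePoly_X (m : ℕ) :
    scalePoly m Polynomial.X = Polynomial.C (C 2) * Polynomial.X :=
  Polynomial.eval₂_X _ _

lemma scalePoly_C (m : ℕ) (a : MvPolynomial (Fin m) ℂ) :
    scalePoly m (Polynomial.C a) = Polynomial.C (scaleBy (fun _ => 1) a) :=
  Polynomial.eval₂_C _ _

lemma coeff_scalePoly (m : ℕ) (h : Polynomial (MvPolynomial (Fin m) ℂ)) (k : ℕ) :
    (scalePoly m h).coeff k = (2 ^ k : ℂ) • scaleBy (fun _ => 1) (h.coeff k) := by
  induction h using Polynomial.induction_on' with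
  | add p q hp hq => rw [map_add, Polynomial.coeff_add, hp, hq, Polynomial.coeff_add, map_add,
      smul_add]
  | monomial l a =>
    rw [← Polynomial.C_mul_X_pow_eq_monomial, map_mul, map_pow, scalePoly_X, scalePoly_C, mul_pow,
      ← Polynomial.C_pow, ← mul_assoc, ← Polynomial.C_mul, Polynomial.coeff_C_mul_X_pow,
      Polynomial.coeff_C_mul_X_pow]
    split_ifs with hk
    · rw [hk, smul_eq_C_mul, mul_comm, C_pow]
    · simp

lemma mem_polySymHom_iff {m s d : ℕ} {h : Polynomial (MvPolynomial (Fin m) ℂ)} :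
    h ∈ polySymHom m s d ↔
      (∀ π : Equiv.Perm (Fin m),
        h.map (rename π : MvPolynomial (Fin m) ℂ →ₐ[ℂ] MvPolynomial (Fin m) ℂ).toRingHom = h) ∧
      (2 ^ s : ℂ) • scalePoly m h = (2 ^ d : ℂ) • h := by
  have h1 : (∀ π : Equiv.Perm (Fin m),
        h.map (rename π : MvPolynomial (Fin m) ℂ →ₐ[ℂ] MvPolynomial (Fin m) ℂ).toRingHom = h) ↔
      ∀ k, (h.coeff k).IsSymmetric := by
    simp only [Polynomial.ext_iff, Polynomial.coeff_map]
    exact forall_comm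
  rw [h1, Polynomial.ext_iff, ← forall_and]
  refine forall_congr' fun k => and_congr_right fun _ => ?_
  rw [Polynomial.coeff_smul, coeff_scalePoly, smul_smul, ← pow_add, Polynomial.coeff_smul]

/-- The factor by which the restriction to a block of `p` coinciding variables is divisible. -/
noncomputable def blockFactor (p m : ℕ) : Polynomial (MvPolynomial (Fin m) ℂ) :=
  Polynomial.C (discr m) * ∏ j : Fin m, (Polynomial.X - Polynomial.C (X j)) ^ p

lemma blockFactor_ne_zero (p m : ℕ) : blockFactor p m ≠ 0 :=
  mul_ne_zero (Polynomial.C_ne_zero.2 (discr_ne_zero m)) <|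
    Finset.prod_ne_zero_iff.2 fun _ _ => pow_ne_zero _ (Polynomial.X_sub_C_ne_zero _)

lemma map_blockFactor (p m : ℕ) (π : Equiv.Perm (Fin m)) :
    (blockFactor p m).map
      (rename π : MvPolynomial (Fin m) ℂ →ₐ[ℂ] MvPolynomial (Fin m) ℂ).toRingHom =
      blockFactor p m := by
  have h : (rename π : MvPolynomial (Fin m) ℂ →ₐ[ℂ] MvPolynomial (Fin m) ℂ).toRingHom (discr m) =
    discr m := isSymmetric_discr m π
  have hX (j : Fin m) :
      (rename π : MvPolynomial (Fin m) ℂ →ₐ[ℂ] MvPolynomial (Fin m) ℂ).toRingHom (X j) =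
      X (π j) := rename_X _ _
  rw [blockFactor, Polynomial.map_mul, Polynomial.map_C, h, Polynomial.map_prod]
  simp only [Polynomial.map_pow, Polynomial.map_sub, Polynomial.map_X, Polynomial.map_C, hX]
  rw [Equiv.prod_comp π fun j => (Polynomial.X - Polynomial.C (X j : MvPolynomial (Fin m) ℂ)) ^ p]

lemma scalePoly_blockFactor (p m : ℕ) :
    scalePoly m (blockFactor p m) = (2 ^ (m * (m - 1) + m * p) : ℂ) • blockFactor p m := by
  have h (j : Fin m) : scalePoly m (Polynomial.X - Polynomial.C (X j)) =
      Polynomial.C (C 2) * (Polynomial.X - Polynomial.C (X j)) := by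
    rw [map_sub, scalePoly_X, scalePoly_C, scaleBy, aeval_X, pow_one, Polynomial.C_mul, mul_sub]
  have hs (c : ℂ) (q : Polynomial (MvPolynomial (Fin m) ℂ)) :
      c • q = Polynomial.C (C c) * q := by
    ext1 k
    rw [Polynomial.coeff_smul, Polynomial.coeff_C_mul, smul_eq_C_mul]
  rw [hs, blockFactor, map_mul, map_prod, scalePoly_C, scaleBy_discr]
  simp only [map_pow, h, mul_pow, Finset.prod_mul_distrib, Finset.prod_const, Finset.card_univ,
    Fintype.card_fin, Polynomial.C_mul]
  ring

lemma algHom_comp_blockSub {n p m : ℕ} (e : Fin n ≃ Fin p ⊕ Fin m) {B : Type*} [CommRing B]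
    [Algebra ℂ B] (ψ : Polynomial (MvPolynomial (Fin m) ℂ) →ₐ[ℂ] B) (f : MvPolynomial (Fin n) ℂ) :
    ψ (blockSub e f) = aeval (fun i => Sum.elim (fun _ => ψ Polynomial.X)
      (fun j => ψ (Polynomial.C (X j))) (e i)) f := by
  rw [blockSub, ← AlgHom.comp_apply, comp_aeval]
  congr 2
  funext i
  rcases e i with k | j <;> rfl

lemma scalePoly_blockSub {n p m : ℕ} (e : Fin n ≃ Fin p ⊕ Fin m) (f : MvPolynomial (Fin n) ℂ) :
    scalePoly m (blockSub e f) = blockSub e (scaleBy (fun _ => 1) f) := by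
  rw [algHom_comp_blockSub, scaleBy, ← AlgHom.comp_apply, comp_aeval]
  congr 2
  funext i
  rw [blockSub, map_mul, aeval_X, aeval_C, Polynomial.algebraMap_apply, algebraMap_eq, pow_one]
  rcases e i with k | j
  · simp [scalePoly_X]
  · simp [scalePoly_C, scaleBy]

lemma map_blockSub {n p m : ℕ} (e : Fin n ≃ Fin p ⊕ Fin m) (f : MvPolynomial (Fin n) ℂ)
    (φ : MvPolynomial (Fin m) ℂ →ₐ[ℂ] MvPolynomial (Fin m) ℂ) :
    (blockSub e f).map φ.toRingHom = aeval (fun i => Sum.elim (fun _ => Polynomial.X)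
      (fun j => Polynomial.C (φ (X j))) (e i)) f := by
  have := algHom_comp_blockSub e (Polynomial.mapAlgHom φ) f
  simp only [Polynomial.coe_mapAlgHom, Polynomial.map_X, Polynomial.map_C] at this
  exact this

lemma map_rename_blockSub {n p m : ℕ} (e : Fin n ≃ Fin p ⊕ Fin m) {f : MvPolynomial (Fin n) ℂ}
    (hf : f.IsSymmetric) (π : Equiv.Perm (Fin m)) :
    (blockSub e f).map
      (rename π : MvPolynomial (Fin m) ℂ →ₐ[ℂ] MvPolynomial (Fin m) ℂ).toRingHom =
      blockSub e f := by
  rw [map_blockSub, blockSub]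
  conv_rhs => rw [← aeval_comp_perm hf _ ((e.trans (Equiv.sumCongr (Equiv.refl _) π)).trans e.symm)]
  congr 2
  funext i
  rcases h : e i with k | j <;> simp [h]

lemma exists_blockSub_eq_blockFactor_mul {n p m d : ℕ} (e : Fin n ≃ Fin p ⊕ Fin m) (hp : 2 ≤ p)
    {f : MvPolynomial (Fin n) ℂ} (hf : f.IsSymmetric) (hd : f.IsHomogeneous d)
    (hv : VanishesOnPairs f)
    (hr : ∀ j, (Polynomial.X - Polynomial.C (X j)) ^ p ∣ blockSub e f) :
    ∃ h ∈ polySymHom m (m * (m - 1) + m * p) d, blockSub e f = blockFactor p m * h := by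
  have hsymm := map_rename_blockSub e hf
  have h1 : Polynomial.C (discr m) ∣ blockSub e f := by
    rw [Polynomial.C_dvd_iff_dvd_coeff]
    intro k
    refine discr_dvd (fun π => ?_) fun i j hij => ?_
    · conv_rhs => rw [← hsymm π]
      rw [Polynomial.coeff_map]
      rfl
    · let t : Fin 4 ↪ Fin n :=
        ⟨fun k => e.symm ((![Sum.inl ⟨0, by omega⟩, Sum.inl ⟨1, by omega⟩, Sum.inr i,
          Sum.inr j] : Fin 4 → Fin p ⊕ Fin m) k), fun k l hkl => by
            have := e.symm.injective hkl
            revert this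
            fin_cases k <;> fin_cases l <;> simp [hij, hij.symm]⟩
      have t0 : t 0 = e.symm (Sum.inl ⟨0, by omega⟩) := rfl
      have t1 : t 1 = e.symm (Sum.inl ⟨1, by omega⟩) := rfl
      have t2 : t 2 = e.symm (Sum.inr i) := rfl
      have t3 : t 3 = e.symm (Sum.inr j) := rfl
      have := map_blockSub e f
        (aeval (R := ℂ) (Function.update (X : Fin m → MvPolynomial (Fin m) ℂ) i (X j)))
      rw [hv _ t (by simp [t0, t1]) (by simp [t2, t3, Function.update_apply])] at this
      have := congrArg (fun q => Polynomial.coeff q k) this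
      rw [Polynomial.coeff_map, Polynomial.coeff_zero] at this
      exact this
  obtain ⟨F, hF⟩ := h1
  have h2 (j : Fin m) : (Polynomial.X - Polynomial.C (X j)) ^ p ∣ F := by
    refine (Polynomial.prime_X_sub_C (X j : MvPolynomial (Fin m) ℂ)).pow_dvd_of_dvd_mul_left p ?_
      (hF ▸ hr j)
    rw [Polynomial.dvd_iff_isRoot, Polynomial.IsRoot, Polynomial.eval_C]
    exact discr_ne_zero m
  have h3 : ∏ j : Fin m, (Polynomial.X - Polynomial.C (X j)) ^ p ∣ F := by
    refine Finset.prod_dvd_of_isRelPrime (fun i _ j _ hij => ?_) fun j _ => h2 j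
    refine IsRelPrime.pow ?_
    rw [(Polynomial.prime_X_sub_C _).irreducible.isRelPrime_iff_not_dvd,
      Polynomial.dvd_iff_isRoot, Polynomial.IsRoot, Polynomial.eval_sub, Polynomial.eval_X,
      Polynomial.eval_C]
    exact X_sub_X_ne_zero hij.symm
  obtain ⟨h, rfl⟩ := h3
  rw [← mul_assoc] at hF
  change _ = blockFactor p m * h at hF
  refine ⟨h, mem_polySymHom_iff.2 ⟨fun π => ?_, ?_⟩, hF⟩
  · have := hsymm π
    rw [hF, Polynomial.map_mul, map_blockFactor] at this
    exact mul_left_cancel₀ (blockFactor_ne_zero p m) this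
  · have := scalePoly_blockSub e f
    rw [(isHomogeneous_iff_scaleBy d f).1 hd, map_smul, hF, map_mul, scalePoly_blockFactor,
      smul_mul_assoc, ← mul_smul_comm, ← mul_smul_comm] at this
    exact mul_left_cancel₀ (blockFactor_ne_zero p m) this

section

variable {p m : ℕ} {B : Type*} [CommRing B] [Algebra ℂ B]

/-- Evaluation of a polynomial in `x, y_1, …, y_m`, where `x` takes the value `v (inl a)`. -/
noncomputable def evalBlocks (v : Fin p ⊕ Fin m → B) (a : Fin p) :
    Polynomial (MvPolynomial (Fin m) ℂ) →ₐ[ℂ] B :=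
  Polynomial.eval₂AlgHom (aeval fun j => v (Sum.inr j)) (v (Sum.inl a)) fun _ => mul_comm _ _

@[simp]
lemma evalBlocks_X (v : Fin p ⊕ Fin m → B) (a : Fin p) :
    evalBlocks v a Polynomial.X = v (Sum.inl a) :=
  Polynomial.eval₂_X _ _

@[simp]
lemma evalBlocks_C (v : Fin p ⊕ Fin m → B) (a : Fin p) (f : MvPolynomial (Fin m) ℂ) :
    evalBlocks v a (Polynomial.C f) = aeval (fun j => v (Sum.inr j)) f :=
  Polynomial.eval₂_C _ _

lemma polynomial_algHom_ext {φ ψ : Polynomial (MvPolynomial (Fin m) ℂ) →ₐ[ℂ] B}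
    (hX : φ Polynomial.X = ψ Polynomial.X)
    (hC : ∀ j, φ (Polynomial.C (X j)) = ψ (Polynomial.C (X j))) : φ = ψ := by
  have h : φ.comp Polynomial.CAlgHom = ψ.comp Polynomial.CAlgHom :=
    MvPolynomial.algHom_ext hC
  exact Polynomial.algHom_ext' h hX

lemma map_evalBlocks {B' : Type*} [CommRing B'] [Algebra ℂ B'] (φ : B →ₐ[ℂ] B')
    (v : Fin p ⊕ Fin m → B) (a : Fin p) (h : Polynomial (MvPolynomial (Fin m) ℂ)) :
    φ (evalBlocks v a h) = evalBlocks (φ ∘ v) a h := by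
  rw [← AlgHom.comp_apply]
  exact DFunLike.congr_fun (polynomial_algHom_ext (by simp) (by simp)) h

/-- The summand of the symmetrization of `h`. -/
noncomputable def blockTerm (v : Fin p ⊕ Fin m → B) (a : Fin p)
    (h : Polynomial (MvPolynomial (Fin m) ℂ)) : B :=
  (∏ t : Fin p, ∏ r : Fin m, (v (Sum.inl t) - v (Sum.inr r))) *
    aeval (fun j => v (Sum.inr j)) (discr m) * evalBlocks v a h

lemma map_blockTerm {B' : Type*} [CommRing B'] [Algebra ℂ B'] (φ : B →ₐ[ℂ] B')
    (v : Fin p ⊕ Fin m → B) (a : Fin p) (h : Polynomial (MvPolynomial (Fin m) ℂ)) :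
    φ (blockTerm v a h) = blockTerm (φ ∘ v) a h := by
  rw [blockTerm, blockTerm, map_mul, map_mul, map_evalBlocks, map_prod,
    ← AlgHom.comp_apply φ (aeval _), comp_aeval]
  simp only [map_prod, map_sub]
  rfl

lemma blockTerm_two_mul {d : ℕ} (v : Fin p ⊕ Fin m → B) (a : Fin p)
    {h : Polynomial (MvPolynomial (Fin m) ℂ)} (hh : h ∈ polySymHom m (m * (m - 1) + m * p) d) :
    blockTerm (fun x => algebraMap ℂ B 2 * v x) a h = (2 ^ d : ℂ) • blockTerm v a h := by
  have h1 : evalBlocks (fun x => algebraMap ℂ B 2 * v x) a h =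
      evalBlocks v a (scalePoly m h) := by
    rw [← AlgHom.comp_apply]
    refine DFunLike.congr_fun (polynomial_algHom_ext ?_ fun j => ?_) h
    · simp [scalePoly_X]
    · simp [scalePoly_C, scaleBy]
  have h2 : aeval (fun j => algebraMap ℂ B 2 * v (Sum.inr j)) (discr m) =
      algebraMap ℂ B (2 ^ (m * (m - 1))) * aeval (fun j => v (Sum.inr j)) (discr m) := by
    have := congrArg (aeval fun j => v (Sum.inr j)) (scaleBy_discr m)
    rw [scaleBy, ← AlgHom.comp_apply, comp_aeval, map_mul, aeval_C] at this
    rw [← this]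
    congr 2
    funext j
    simp
  have h3 := (mem_polySymHom_iff.1 hh).2
  have h4 := congrArg (evalBlocks v a) h3
  rw [map_smul, map_smul, Algebra.smul_def, Algebra.smul_def, pow_add, map_mul] at h4
  rw [blockTerm, h1, h2]
  simp only [← mul_sub, Finset.prod_mul_distrib, Finset.prod_const, Finset.card_univ,
    Fintype.card_fin]
  rw [blockTerm, Algebra.smul_def]
  simp only [map_pow] at h4 ⊢
  linear_combination (∏ t : Fin p, ∏ r : Fin m, (v (Sum.inl t) - v (Sum.inr r))) *
    aeval (fun j => v (Sum.inr j)) (discr m) * h4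

lemma aeval_discr_eq_zero {v : Fin m → B} {i j : Fin m} (hij : i ≠ j) (h : v i = v j) :
    aeval v (discr m) = 0 := by
  rw [aeval_discr, Matrix.det_zero_of_row_eq hij, zero_pow two_ne_zero]
  funext k
  simp [Matrix.vandermonde_apply, h]

lemma blockTerm_eq_zero {v : Fin p ⊕ Fin m → B} (a : Fin p)
    (h : Polynomial (MvPolynomial (Fin m) ℂ)) {x y : Fin p ⊕ Fin m} (hxy : x ≠ y)
    (hv : v x = v y) (hl : ¬ (x.isLeft ∧ y.isLeft)) : blockTerm v a h = 0 := by
  have key (t : Fin p) (r : Fin m) (h' : v (Sum.inl t) = v (Sum.inr r)) :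
      blockTerm v a h = 0 := by
    rw [blockTerm, Finset.prod_eq_zero (Finset.mem_univ t), zero_mul, zero_mul]
    exact Finset.prod_eq_zero (Finset.mem_univ r) (sub_eq_zero.2 h')
  rcases x with x | x <;> rcases y with y | y
  · simp at hl
  · exact key x y hv
  · exact key y x hv.symm
  · rw [blockTerm, aeval_discr_eq_zero (v := fun j => v (Sum.inr j))
      (fun h => hxy (congrArg _ h)) hv, mul_zero, zero_mul]

end

section

variable {n p m : ℕ}

/-- The sum over all placements of the two blocks. -/
noncomputable def blockSymm (n : ℕ) (a : Fin p) (h : Polynomial (MvPolynomial (Fin m) ℂ)) :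
    MvPolynomial (Fin n) ℂ :=
  ∑ e : Fin n ≃ Fin p ⊕ Fin m, blockTerm (fun x => X (e.symm x)) a h

lemma aeval_blockSymm {B : Type*} [CommRing B] [Algebra ℂ B] (g : Fin n → B) (a : Fin p)
    (h : Polynomial (MvPolynomial (Fin m) ℂ)) :
    aeval g (blockSymm n a h) =
      ∑ e : Fin n ≃ Fin p ⊕ Fin m, blockTerm (fun x => g (e.symm x)) a h := by
  rw [blockSymm, map_sum]
  refine Finset.sum_congr rfl fun e _ => ?_
  rw [map_blockTerm]
  congr 1
  funext x
  simp

lemma isSymmetric_blockSymm (a : Fin p) (h : Polynomial (MvPolynomial (Fin m) ℂ)) :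
    (blockSymm n a h).IsSymmetric := by
  intro π
  have : rename π (blockSymm n a h) = aeval (R := ℂ) (fun i => X (π i)) (blockSymm n a h) :=
    DFunLike.congr_fun (MvPolynomial.algHom_ext fun i => by simp) _
  rw [this, aeval_blockSymm, blockSymm]
  exact Fintype.sum_equiv (Equiv.equivCongr π (Equiv.refl _)) _ _ fun e => rfl

lemma isHomogeneous_blockSymm {d : ℕ} (a : Fin p) {h : Polynomial (MvPolynomial (Fin m) ℂ)}
    (hh : h ∈ polySymHom m (m * (m - 1) + m * p) d) : (blockSymm n a h).IsHomogeneous d := by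
  rw [isHomogeneous_iff_scaleBy, scaleBy, aeval_blockSymm, blockSymm, Finset.smul_sum]
  refine Finset.sum_congr rfl fun e _ => ?_
  rw [← blockTerm_two_mul _ a hh]
  simp [algebraMap_eq]

lemma exists_not_isLeft {q : ℕ} (hq : p < q) (e : Fin n ≃ Fin p ⊕ Fin m) (t : Fin q ↪ Fin n) :
    ∃ k, ¬ (e (t k)).isLeft := by
  by_contra! h
  have := Fintype.card_le_of_injective (fun k => (e (t k)).getLeft (h k)) fun k l hkl => by
    have := congrArg (Sum.inl (β := Fin m)) hkl
    simpa using this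
  simp at this
  omega

lemma vanishesOnBlocks_blockSymm {q : ℕ} (hq : p < q) (hq2 : 2 ≤ q) (a : Fin p)
    (h : Polynomial (MvPolynomial (Fin m) ℂ)) : VanishesOnBlocks q (blockSymm n a h) := by
  intro B _ _ g t b hb
  rw [aeval_blockSymm]
  refine Finset.sum_eq_zero fun e _ => ?_
  obtain ⟨k, hk⟩ := exists_not_isLeft hq e t
  have : Nontrivial (Fin q) := Fin.nontrivial_iff_two_le.2 hq2
  obtain ⟨l, hl⟩ := exists_ne k
  exact blockTerm_eq_zero a h (x := e (t k)) (y := e (t l)) (by simpa using hl.symm)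
    (by simp [hb]) fun h => hk h.1

lemma vanishesOnPairs_blockSymm (hp : p < 4) (a : Fin p)
    (h : Polynomial (MvPolynomial (Fin m) ℂ)) : VanishesOnPairs (blockSymm n a h) := by
  intro B _ _ g t h1 h2
  rw [aeval_blockSymm]
  refine Finset.sum_eq_zero fun e _ => ?_
  obtain ⟨k, hk⟩ := exists_not_isLeft hp e t
  fin_cases k
  · exact blockTerm_eq_zero a h (x := e (t 0)) (y := e (t 1)) (by simp) (by simp [h1])
      fun h => hk h.1
  · exact blockTerm_eq_zero a h (x := e (t 0)) (y := e (t 1)) (by simp) (by simp [h1])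
      fun h => hk h.2
  · exact blockTerm_eq_zero a h (x := e (t 2)) (y := e (t 3)) (by simp) (by simp [h2])
      fun h => hk h.1
  · exact blockTerm_eq_zero a h (x := e (t 2)) (y := e (t 3)) (by simp) (by simp [h2])
      fun h => hk h.2

lemma blockTerm_sumCongr (τ : Equiv.Perm (Fin p)) (π : Equiv.Perm (Fin m)) (a : Fin p)
    {h : Polynomial (MvPolynomial (Fin m) ℂ)}
    (hh : h.map (rename π : MvPolynomial (Fin m) ℂ →ₐ[ℂ] MvPolynomial (Fin m) ℂ).toRingHom = h) :
    blockTerm (fun x => Sum.elim (fun _ => (Polynomial.X : Polynomial (MvPolynomial (Fin m) ℂ)))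
      (fun j => Polynomial.C (X j))
      (Equiv.Perm.sumCongr τ π x)) a h = blockFactor p m * h := by
  have h1 : evalBlocks (fun x => Sum.elim (fun _ => (Polynomial.X : Polynomial (MvPolynomial (Fin m) ℂ)))
      (fun j => Polynomial.C (X j))
      (Equiv.Perm.sumCongr τ π x)) a h = h := by
    conv_rhs => rw [← hh]
    refine (DFunLike.congr_fun (polynomial_algHom_ext (ψ := Polynomial.mapAlgHom (rename π))
      ?_ fun j => ?_) h).trans rfl
    · simp
    · simp
  have h2 : aeval (fun j => (Polynomial.C (X (π j)) : Polynomial (MvPolynomial (Fin m) ℂ)))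
      (discr m) = Polynomial.C (discr m) := by
    have : aeval (fun j => (Polynomial.C (X (π j)) : Polynomial (MvPolynomial (Fin m) ℂ))) =
        (Polynomial.CAlgHom (R := ℂ)).comp (rename π) :=
      MvPolynomial.algHom_ext fun j => by simp
    rw [this, AlgHom.comp_apply, isSymmetric_discr m π]
    rfl
  rw [blockTerm, h1, blockFactor]
  simp only [Equiv.Perm.sumCongr_apply, Sum.map_inl, Sum.map_inr, Sum.elim_inl, Sum.elim_inr,
    Finset.prod_const, Finset.card_univ, Fintype.card_fin, h2]
  rw [Equiv.prod_comp π fun j => (Polynomial.X - Polynomial.C (X j : MvPolynomial (Fin m) ℂ)),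
    Finset.prod_pow, mul_comm (Polynomial.C _)]

lemma exists_blockSub_blockSymm (e : Fin n ≃ Fin p ⊕ Fin m) (hp : 2 ≤ p) (a : Fin p)
    {h : Polynomial (MvPolynomial (Fin m) ℂ)}
    (hh : ∀ π : Equiv.Perm (Fin m),
      h.map (rename π : MvPolynomial (Fin m) ℂ →ₐ[ℂ] MvPolynomial (Fin m) ℂ).toRingHom = h) :
    ∃ c : ℕ, c ≠ 0 ∧ blockSub e (blockSymm n a h) = c • (blockFactor p m * h) := by
  classical
  have : Nontrivial (Fin p) := Fin.nontrivial_iff_two_le.2 hp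
  set W : Fin p ⊕ Fin m → Polynomial (MvPolynomial (Fin m) ℂ) :=
    Sum.elim (fun _ => Polynomial.X) (fun j => Polynomial.C (X j)) with hW
  have hsum : blockSub e (blockSymm n a h) =
      ∑ σ : Equiv.Perm (Fin p ⊕ Fin m), blockTerm (fun x => W (σ.symm x)) a h := by
    rw [blockSub, aeval_blockSymm]
    exact Fintype.sum_equiv (Equiv.equivCongr e (Equiv.refl _)) _ _ fun e' => by simp [hW]
  have hterm (σ : Equiv.Perm (Fin p ⊕ Fin m)) : blockTerm (fun x => W (σ.symm x)) a h =
      if σ ∈ (Equiv.Perm.sumCongrHom (Fin p) (Fin m)).range then blockFactor p m * h else 0 := by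
    split_ifs with hσ
    · obtain ⟨⟨τ, π⟩, rfl⟩ := hσ
      exact blockTerm_sumCongr τ⁻¹ π⁻¹ a (hh _)
    · have : ¬ Set.MapsTo σ (Set.range Sum.inl) (Set.range Sum.inl) := fun hm =>
        hσ (Equiv.Perm.mem_sumCongrHom_range_of_perm_mapsTo_inl hm)
      rw [Set.MapsTo] at this
      push Not at this
      obtain ⟨_, ⟨t, rfl⟩, ht⟩ := this
      obtain ⟨t', ht'⟩ := exists_ne t
      refine blockTerm_eq_zero a h (x := σ (Sum.inl t)) (y := σ (Sum.inl t'))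
        (by simpa using ht'.symm) (by simp [hW]) fun h => ht ?_
      obtain ⟨s, hs⟩ := Sum.isLeft_iff.1 h.1
      exact ⟨s, hs.symm⟩
  rw [hsum, Finset.sum_congr rfl fun σ _ => hterm σ, ← Finset.sum_filter, Finset.sum_const]
  exact ⟨_, Finset.card_ne_zero.2 ⟨1, Finset.mem_filter.2 ⟨Finset.mem_univ _, one_mem _⟩⟩, rfl⟩

end

lemma exists_vanishes_blockSub_eq {n p m d : ℕ} (e : Fin n ≃ Fin p ⊕ Fin m) (hp : 2 ≤ p)
    (hp4 : p < 4) {h : Polynomial (MvPolynomial (Fin m) ℂ)}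
    (hh : h ∈ polySymHom m (m * (m - 1) + m * p) d) :
    ∃ f : MvPolynomial (Fin n) ℂ, f.IsSymmetric ∧ f.IsHomogeneous d ∧ VanishesOnPairs f ∧
      VanishesOnBlocks (p + 1) f ∧ blockSub e f = blockFactor p m * h := by
  let a : Fin p := ⟨0, by omega⟩
  obtain ⟨c, hc, hs⟩ := exists_blockSub_blockSymm e hp a (mem_polySymHom_iff.1 hh).1
  refine ⟨(c : ℂ)⁻¹ • blockSymm n a h, (isSymmetric_blockSymm a h).smul _, ?_, ?_, ?_, ?_⟩
  · exact (homogeneousSubmodule (Fin n) ℂ d).smul_mem _ (isHomogeneous_blockSymm a hh)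
  · intro B _ _ g t h1 h2
    rw [map_smul, vanishesOnPairs_blockSymm hp4 a h g t h1 h2, smul_zero]
  · intro B _ _ g t b hb
    rw [map_smul, vanishesOnBlocks_blockSymm p.lt_succ_self (by omega) a h g t b hb, smul_zero]
  · rw [map_smul, hs, ← Nat.cast_smul_eq_nsmul ℂ, inv_smul_smul₀ (Nat.cast_ne_zero.2 hc)]

lemma mem_IComponent {n : ℕ} {hn : 4 ≤ n} {d : ℕ} {f : MvPolynomial (Fin n) ℂ} :
    f ∈ IComponent n hn d ↔ f.IsSymmetric ∧ f.IsHomogeneous d ∧ VanishesOnPairs f := by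
  have : f ∈ IComponent n hn d ↔ (f.IsSymmetric ∧ aeval (R := ℂ)
      (fun i : Fin n => if (i : ℕ) = 1 then X (⟨0, by omega⟩ : Fin n)
        else if (i : ℕ) = 3 then X (⟨2, by omega⟩ : Fin n)
        else (X i : MvPolynomial (Fin n) ℂ)) f = 0) ∧ f.IsHomogeneous d := Iff.rfl
  rw [this, and_assoc, and_comm (b := f.IsHomogeneous d)]
  exact and_congr_right fun hf => and_congr_right fun _ => (vanishesOnPairs_iff hn hf).symm

lemma finrank_eq_finrank_inf_ker_add_finrank_map {V W : Type*} [AddCommGroup V] [Module ℂ V]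
    [AddCommGroup W] [Module ℂ W] (S : Submodule ℂ V) [FiniteDimensional ℂ S] (f : V →ₗ[ℂ] W) :
    Module.finrank ℂ S =
      Module.finrank ℂ (S ⊓ LinearMap.ker f : Submodule ℂ V) + Module.finrank ℂ (S.map f) := by
  rw [← LinearMap.finrank_range_add_finrank_ker (f.domRestrict S), LinearMap.range_domRestrict,
    LinearMap.ker_domRestrict, add_comm, ← Submodule.map_comap_subtype,
    (Submodule.equivMapOfInjective S.subtype S.injective_subtype _).finrank_eq]

lemma finrank_map_mulLeft {A : Type*} [CommRing A] [IsDomain A] [Algebra ℂ A] {a : A} (ha : a ≠ 0)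
    (S : Submodule ℂ A) :
    Module.finrank ℂ (S.map (LinearMap.mulLeft ℂ a)) = Module.finrank ℂ S :=
  (Submodule.equivMapOfInjective _ (mul_right_injective₀ ha) S).finrank_eq.symm

lemma map_blockSub_eq {n p m d : ℕ} (e : Fin n ≃ Fin p ⊕ Fin m) (hp : 2 ≤ p) (hp4 : p < 4)
    {V : Submodule ℂ (MvPolynomial (Fin n) ℂ)}
    (h1 : ∀ f ∈ V, f.IsSymmetric ∧ f.IsHomogeneous d ∧ VanishesOnPairs f ∧
      ∀ j, (Polynomial.X - Polynomial.C (X j)) ^ p ∣ blockSub e f)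
    (h2 : ∀ f : MvPolynomial (Fin n) ℂ, f.IsSymmetric → f.IsHomogeneous d → VanishesOnPairs f →
      VanishesOnBlocks (p + 1) f → f ∈ V) :
    V.map (blockSub e).toLinearMap = (polySymHom m (m * (m - 1) + m * p) d).map
      (LinearMap.mulLeft ℂ (blockFactor p m)) := by
  ext F
  constructor
  · rintro ⟨f, hf, rfl⟩
    obtain ⟨hs, hd, hv, hr⟩ := h1 f hf
    obtain ⟨h, hh, he⟩ := exists_blockSub_eq_blockFactor_mul e hp hs hd hv hr
    exact ⟨h, hh, he.symm⟩
  · rintro ⟨h, hh, rfl⟩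
    obtain ⟨f, hs, hd, hv, hb, he⟩ := exists_vanishes_blockSub_eq e hp hp4 hh
    exact ⟨f, h2 f hs hd hv hb, he⟩

lemma blockSub_eq_zero_of_vanishesOnBlocks {n p m : ℕ} (e : Fin n ≃ Fin p ⊕ Fin m)
    {f : MvPolynomial (Fin n) ℂ} (h : VanishesOnBlocks p f) : blockSub e f = 0 :=
  h _ (Function.Embedding.inl.trans e.symm.toEmbedding) Polynomial.X fun i => by simp

lemma inf_ker_blockSub_eq {n d : ℕ} (hn : 4 ≤ n) (e₃ : Fin n ≃ Fin 3 ⊕ Fin (n - 3))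
    (e₂ : Fin n ≃ Fin 2 ⊕ Fin (n - 2)) :
    IComponent n hn d ⊓ LinearMap.ker (blockSub e₃).toLinearMap ⊓
        LinearMap.ker (blockSub e₂).toLinearMap =
      (symHom n (n * (n - 1)) d).map (LinearMap.mulLeft ℂ (discr n)) := by
  ext f
  constructor
  · rintro ⟨⟨hf, -⟩, hf2⟩
    obtain ⟨hs, hd, -⟩ := mem_IComponent.1 hf
    obtain ⟨k, rfl⟩ := discr_dvd hs fun i j hij => by
      refine aeval_eq_zero_of_blockSub_eq_zero e₂ hs hf2 _
        ⟨![i, j], fun a b => by fin_cases a <;> fin_cases b <;> simp [hij, hij.symm]⟩ (X j)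
        fun a => ?_
      have h : (![i, j] : Fin 2 → Fin n) a = i ∨ (![i, j] : Fin 2 → Fin n) a = j := by
        fin_cases a <;> simp
      change Function.update X i (X j) ((![i, j] : Fin 2 → Fin n) a) = X j
      rcases h with h | h <;> simp [h, hij.symm]
    refine ⟨k, ⟨fun π => ?_, ?_⟩, rfl⟩
    · have := hs π
      rw [map_mul, isSymmetric_discr] at this
      exact mul_left_cancel₀ (discr_ne_zero n) this
    · rw [isHomogeneous_iff_scaleBy, map_mul, scaleBy_discr] at hd
      refine mul_left_cancel₀ (discr_ne_zero n) ?_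
      rw [mul_smul_comm, mul_smul_comm, ← hd, smul_eq_C_mul]
      ring
  · rintro ⟨k, ⟨hk, hk'⟩, rfl⟩
    have hv {B : Type} [CommRing B] [Algebra ℂ B] (g : Fin n → B) {i j : Fin n} (hij : i ≠ j)
        (h : g i = g j) : aeval g (discr n * k) = 0 := by
      rw [map_mul, aeval_discr_eq_zero hij h, zero_mul]
    have hb (p : ℕ) (hp : 2 ≤ p) : VanishesOnBlocks p (discr n * k) := fun g t b h =>
      hv g (i := t ⟨0, by omega⟩) (j := t ⟨1, by omega⟩) (by simp) ((h _).trans (h _).symm)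
    refine ⟨⟨mem_IComponent.2 ⟨(isSymmetric_discr n).mul hk, ?_, fun g t h _ =>
      hv g (by simp) h⟩, blockSub_eq_zero_of_vanishesOnBlocks e₃ (hb 3 (by norm_num))⟩,
      blockSub_eq_zero_of_vanishesOnBlocks e₂ (hb 2 le_rfl)⟩
    rw [LinearMap.mulLeft_apply, isHomogeneous_iff_scaleBy, map_mul, scaleBy_discr,
      ← mul_smul_comm, ← hk', smul_eq_C_mul]
    ring

/-- Separation of the first `p` positions. -/
def splitFin {n p : ℕ} (h : p ≤ n) : Fin n ≃ Fin p ⊕ Fin (n - p) :=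
  (finCongr (Nat.add_sub_cancel' h).symm).trans finSumFinEquiv.symm

lemma finrank_IComponent {n : ℕ} (hn : 4 ≤ n) (d : ℕ) :
    Module.finrank ℂ (IComponent n hn d) =
      Module.finrank ℂ (polySymHom (n - 3) ((n - 3) * (n - 3 - 1) + (n - 3) * 3) d) +
      Module.finrank ℂ (polySymHom (n - 2) ((n - 2) * (n - 2 - 1) + (n - 2) * 2) d) +
      Module.finrank ℂ (symHom n (n * (n - 1)) d) := by
  set V := IComponent n hn d
  let e₃ : Fin n ≃ Fin 3 ⊕ Fin (n - 3) := splitFin (by omega)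
  let e₂ : Fin n ≃ Fin 2 ⊕ Fin (n - 2) := splitFin (by omega)
  have hV : V ≤ symHom n 0 d := fun f hf => by
    obtain ⟨hs, hd, -⟩ := mem_IComponent.1 hf
    refine ⟨hs, ?_⟩
    rw [pow_zero, one_smul]
    exact (isHomogeneous_iff_scaleBy d f).1 hd
  have : FiniteDimensional ℂ (symHom n 0 d) := (finrank_symHom n 0 d).1
  have : FiniteDimensional ℂ V := Submodule.finiteDimensional_of_le hV
  have : FiniteDimensional ℂ (V ⊓ LinearMap.ker (blockSub e₃).toLinearMap : Submodule ℂ _) :=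
    Submodule.finiteDimensional_of_le inf_le_left
  rw [finrank_eq_finrank_inf_ker_add_finrank_map V (blockSub e₃).toLinearMap,
    finrank_eq_finrank_inf_ker_add_finrank_map (V ⊓ _) (blockSub e₂).toLinearMap,
    inf_ker_blockSub_eq, map_blockSub_eq (d := d) e₃ (by norm_num) (by norm_num),
    map_blockSub_eq (d := d) e₂ (by norm_num) (by norm_num),
    finrank_map_mulLeft (discr_ne_zero n), finrank_map_mulLeft (blockFactor_ne_zero _ _),
    finrank_map_mulLeft (blockFactor_ne_zero _ _)]
  · ring
  · rintro f ⟨hf, hf3⟩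
    obtain ⟨hs, hd, hv⟩ := mem_IComponent.1 hf
    exact ⟨hs, hd, hv, X_sub_C_sq_dvd_blockSub e₂ hs
      (aeval_eq_zero_of_blockSub_eq_zero e₃ hs hf3)⟩
  · intro f hs hd hv hb
    exact ⟨mem_IComponent.2 ⟨hs, hd, hv⟩, blockSub_eq_zero_of_vanishesOnBlocks e₃ hb⟩
  · intro f hf
    obtain ⟨hs, hd, hv⟩ := mem_IComponent.1 hf
    exact ⟨hs, hd, hv, X_sub_C_cube_dvd_blockSub e₃ hs hv⟩
  · intro f hs hd hv _
    exact mem_IComponent.2 ⟨hs, hd, hv⟩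

theorem hilbert_series_of_In (n : ℕ) (hn : 4 ≤ n) :
    PowerSeries.mk (fun d => (Module.finrank ℂ (IComponent n hn d) : ℚ)) =
      PowerSeries.X ^ ((n - 1) * (n - 3)) * (qPoch 1 * qPoch (n - 3))⁻¹
      + PowerSeries.X ^ ((n - 2) * (n - 1)) * (qPoch 1 * qPoch (n - 2))⁻¹
      + PowerSeries.X ^ (n * (n - 1)) * (qPoch n)⁻¹ := by
  have h1 : (n - 1) * (n - 3) = (n - 3) * (n - 3 - 1) + (n - 3) * 3 := by
    obtain ⟨k, rfl⟩ := Nat.exists_eq_add_of_le' hn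
    simp only [Nat.reduceSubDiff]
    ring
  have h2 : (n - 2) * (n - 1) = (n - 2) * (n - 2 - 1) + (n - 2) * 2 := by
    obtain ⟨k, rfl⟩ := Nat.exists_eq_add_of_le' hn
    simp only [Nat.reduceSubDiff]
    ring
  ext d
  rw [PowerSeries.coeff_mk, finrank_IComponent, map_add, map_add, h1, h2,
    ← (finrank_polySymHom _ _ d).2, ← (finrank_polySymHom _ _ d).2, ← (finrank_symHom _ _ d).2]
  push_cast
  rfl
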